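/- Let k ≥ 1 be an integer with k ≢ 3 (mod 9) such that D is squarefree, and let p be a prime such that S_k(x) is irreducible in 𝔽_p[x]. Let θ be a root of the irreducible polynomial S_k(x^p), let L = ℚ(θ), and let Z_L be the ring of integers of L. Then p divides the index [Z_L : ℤ[θ]] if and only if the image of the polynomial S_k(x^p) is zero in the ring (ℤ/p²ℤ)[x]/(S_k(x)). -/

import Mathlib

open Polynomial IntermediateField

theorem exists_eq_add_C_mul_of_map_eq {n : ℕ} {f g : ℤ[X]}
    (h : f.map (Int.castRingHom (ZMod n)) = g.map (Int.castRingHom (ZMod n))) :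
    ∃ r : ℤ[X], f = g + (n : ℤ[X]) * r := by
  have hdvd : C (n : ℤ) ∣ f - g := by
    rw [C_dvd_iff_dvd_coeff]
    intro i
    rw [← ZMod.intCast_zmod_eq_zero_iff_dvd]
    have := congrArg (fun q => coeff q i) h
    simp only [coeff_map, eq_intCast] at this
    simp [this]
  obtain ⟨r, hr⟩ := hdvd
  exact ⟨r, by rw [← sub_eq_iff_eq_add', hr]; simp⟩

theorem map_dvd_map_sq_iff {p : ℕ} (hp : p.Prime) {S F G : ℤ[X]}
    (hirr : Irreducible (S.map (Int.castRingHom (ZMod p)))) (hF : F = S ^ p + (p : ℤ[X]) * G) :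
    S.map (Int.castRingHom (ZMod (p ^ 2))) ∣ F.map (Int.castRingHom (ZMod (p ^ 2))) ↔
      S.map (Int.castRingHom (ZMod p)) ∣ G.map (Int.castRingHom (ZMod p)) := by
  have : Fact p.Prime := ⟨hp⟩
  have hpow : S ^ p = S * S ^ (p - 1) := (mul_pow_sub_one hp.ne_zero S).symm
  have hC : (p : ℤ[X]) ≠ 0 := by exact_mod_cast hp.ne_zero
  constructor
  · rintro ⟨q, hq⟩
    obtain ⟨Q, rfl⟩ := map_surjective (Int.castRingHom (ZMod (p ^ 2))) (ZMod.ringHom_surjective _) q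
    rw [← Polynomial.map_mul] at hq
    obtain ⟨R, hR⟩ := exists_eq_add_C_mul_of_map_eq hq
    have hFp : (S * Q).map (Int.castRingHom (ZMod p)) =
        (S * S ^ (p - 1)).map (Int.castRingHom (ZMod p)) := by
      have := congrArg (Polynomial.map (Int.castRingHom (ZMod p))) (hR.symm.trans hF)
      rw [← hpow]
      simpa using this
    rw [Polynomial.map_mul, Polynomial.map_mul] at hFp
    obtain ⟨Q', rfl⟩ := exists_eq_add_C_mul_of_map_eq (mul_left_cancel₀ hirr.ne_zero hFp)
    have hG : G = S * Q' + (p : ℤ[X]) * R := by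
      apply mul_left_cancel₀ hC
      have := hF.symm.trans hR
      rw [hpow] at this
      push_cast at this
      linear_combination this
    rw [hG]
    simp
  · rintro ⟨q, hq⟩
    obtain ⟨Q, rfl⟩ := map_surjective (Int.castRingHom (ZMod p)) (ZMod.ringHom_surjective _) q
    rw [← Polynomial.map_mul] at hq
    obtain ⟨R, rfl⟩ := exists_eq_add_C_mul_of_map_eq hq
    have hF' : F = S * (S ^ (p - 1) + (p : ℤ[X]) * Q) + ((p ^ 2 : ℕ) : ℤ[X]) * R := by
      rw [hF, hpow]
      push_cast
      ring
    have h0 : (((p ^ 2 : ℕ) : ℤ[X])).map (Int.castRingHom (ZMod (p ^ 2))) = 0 := by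
      rw [Polynomial.map_natCast, CharP.cast_eq_zero]
    rw [hF']
    simp only [Polynomial.map_add, Polynomial.map_mul, h0, zero_mul, add_zero]
    exact dvd_mul_right _ _

theorem map_dvd_map_of_mul_mem_adjoin {R : Type*} [CommRing R] [IsDomain R] [CharZero R]
    {p : ℕ} (hp : p.Prime) (hunit : ¬ IsUnit (p : R)) {S G : ℤ[X]}
    (hirr : Irreducible (S.map (Int.castRingHom (ZMod p)))) {θ : R}
    (hθ : aeval θ (S ^ p + (p : ℤ[X]) * G) = 0) {x : R}
    (hpx : (p : R) * x ∈ Algebra.adjoin ℤ {θ}) (hx : x ∉ Algebra.adjoin ℤ {θ}) :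
    S.map (Int.castRingHom (ZMod p)) ∣ G.map (Int.castRingHom (ZMod p)) := by
  have : Fact p.Prime := ⟨hp⟩
  have hp0 : (p : R) ≠ 0 := by exact_mod_cast hp.ne_zero
  simp only [map_add, map_mul, map_pow, map_natCast]
    at hθ
  rw [Algebra.adjoin_singleton_eq_range_aeval] at hpx hx
  obtain ⟨Y, hY⟩ := hpx
  change aeval θ Y = _ at hY
  set φ := Int.castRingHom (ZMod p)
  have hYdvd : ¬ (S.map φ) ^ p ∣ Y.map φ := by
    rintro ⟨q, hq⟩
    obtain ⟨Q, rfl⟩ := map_surjective φ (ZMod.ringHom_surjective _) q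
    rw [← Polynomial.map_pow, ← Polynomial.map_mul] at hq
    obtain ⟨T, rfl⟩ := exists_eq_add_C_mul_of_map_eq hq
    apply hx
    refine ⟨T - G * Q, ?_⟩
    change aeval θ _ = _
    apply mul_left_cancel₀ hp0
    rw [← hY]
    simp only [map_add, map_sub, map_mul, map_pow, map_natCast]
    linear_combination (-aeval θ Q) * hθ
  obtain ⟨z, hz⟩ : ∃ z, aeval θ S ^ (p - 1) = (p : R) * z := by
    have hgcd : EuclideanDomain.gcd ((S.map φ) ^ p) (Y.map φ) ∣ (S.map φ) ^ (p - 1) := by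
      obtain ⟨j, hj, hass⟩ := (dvd_prime_pow hirr.prime p).1
        (EuclideanDomain.gcd_dvd_left ((S.map φ) ^ p) (Y.map φ))
      have hjp : j ≠ p := by
        rintro rfl
        exact hYdvd (hass.symm.dvd.trans (EuclideanDomain.gcd_dvd_right _ _))
      exact hass.dvd.trans (pow_dvd_pow _ (by omega))
    obtain ⟨c, hc⟩ := hgcd
    rw [EuclideanDomain.gcd_eq_gcd_ab] at hc
    obtain ⟨A, hA⟩ := map_surjective φ (ZMod.ringHom_surjective _)
      (EuclideanDomain.gcdA ((S.map φ) ^ p) (Y.map φ))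
    obtain ⟨B, hB⟩ := map_surjective φ (ZMod.ringHom_surjective _)
      (EuclideanDomain.gcdB ((S.map φ) ^ p) (Y.map φ))
    obtain ⟨D, rfl⟩ := map_surjective φ (ZMod.ringHom_surjective _) c
    rw [← hA, ← hB] at hc
    simp only [← Polynomial.map_pow, ← Polynomial.map_mul, ← Polynomial.map_add] at hc
    obtain ⟨T, hT⟩ := exists_eq_add_C_mul_of_map_eq hc
    have := congrArg (aeval θ) hT
    simp only [map_add, map_mul, map_pow, map_natCast, hY] at this
    refine ⟨(-aeval θ G * aeval θ A + x * aeval θ B) * aeval θ D + aeval θ T, ?_⟩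
    linear_combination this + aeval θ A * aeval θ D * hθ
  have hGz : aeval θ G = -(aeval θ S * z) := by
    apply mul_left_cancel₀ hp0
    have h1 := mul_pow_sub_one hp.ne_zero (aeval θ S)
    linear_combination hθ + h1 - aeval θ S * hz
  by_contra hnd
  obtain ⟨a, b, hab⟩ := (hirr.coprime_iff_not_dvd).2 hnd
  obtain ⟨A, rfl⟩ := map_surjective φ (ZMod.ringHom_surjective _) a
  obtain ⟨B, rfl⟩ := map_surjective φ (ZMod.ringHom_surjective _) b
  rw [← Polynomial.map_one φ] at hab
  simp only [← Polynomial.map_mul, ← Polynomial.map_add] at hab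
  obtain ⟨T, hT⟩ := exists_eq_add_C_mul_of_map_eq hab
  have h1 := congrArg (aeval θ) hT
  simp only [map_add, map_mul, map_one, map_natCast, hGz] at h1
  have hcop : IsCoprime (aeval θ S) (p : R) :=
    ⟨aeval θ A - aeval θ B * z, -aeval θ T, by linear_combination h1⟩
  apply hunit
  have h2 : IsCoprime ((p : R) * z) (p : R) := hz ▸ hcop.pow_left
  exact isCoprime_self.1 (h2.of_mul_left_left)

theorem exists_mul_mem_adjoin_of_map_dvd_map {L : Type*} [Field L] [NumberField L]
    {p : ℕ} (hp : p.Prime) {S G : ℤ[X]}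
    (hirr : Irreducible (S.map (Int.castRingHom (ZMod p)))) {θ : NumberField.RingOfIntegers L}
    (hθ : aeval θ (S ^ p + (p : ℤ[X]) * G) = 0)
    (hmin : ∀ T : ℤ[X], aeval θ T = 0 → S ^ p + (p : ℤ[X]) * G ∣ T)
    (hdvd : S.map (Int.castRingHom (ZMod p)) ∣ G.map (Int.castRingHom (ZMod p))) :
    ∃ x, (p : NumberField.RingOfIntegers L) * x ∈ Algebra.adjoin ℤ {θ} ∧
      x ∉ Algebra.adjoin ℤ {θ} := by
  have : Fact p.Prime := ⟨hp⟩
  have hp0 : (p : NumberField.RingOfIntegers L) ≠ 0 := by exact_mod_cast hp.ne_zero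
  have hpL : (p : L) ≠ 0 := by exact_mod_cast hp.ne_zero
  obtain ⟨q, hq⟩ := hdvd
  obtain ⟨Q, rfl⟩ := map_surjective (Int.castRingHom (ZMod p)) (ZMod.ringHom_surjective _) q
  rw [← Polynomial.map_mul] at hq
  obtain ⟨R, rfl⟩ := exists_eq_add_C_mul_of_map_eq hq
  have hθ' := hθ
  simp only [map_add, map_mul, map_pow, map_natCast]
    at hθ'
  set u := aeval θ S with hu
  set t := aeval θ Q
  set r := aeval θ R
  have hup : u ^ p = u * u ^ (p - 2) * u := by
    rw [← pow_succ', ← pow_succ]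
    congr 1
    have := hp.two_le
    omega
  have hup1 : u ^ (p - 1) = u * u ^ (p - 2) := by
    rw [← pow_succ']
    congr 1
    have := hp.two_le
    omega
  let y : L := algebraMap (NumberField.RingOfIntegers L) L (u * u ^ (p - 2) + p * t) / p
  have hy : IsIntegral (NumberField.RingOfIntegers L) y := by
    refine isIntegral_of_smul_mem_submodule (M := L)
      (Submodule.span (NumberField.RingOfIntegers L) {(p : L), algebraMap _ L u}) ?_
      (Submodule.fg_span (by simp)) y ?_
    · intro h
      rw [Submodule.span_eq_bot] at h
      exact hpL (h _ (by simp))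
    · intro n hn
      obtain ⟨a, b, rfl⟩ := Submodule.mem_span_pair.1 hn
      rw [Submodule.mem_span_pair]
      refine ⟨a * t - b * r, a * u ^ (p - 2), ?_⟩
      have h3 := congrArg (algebraMap (NumberField.RingOfIntegers L) L) hθ'
      rw [hup] at h3
      simp only [Algebra.smul_def, map_add, map_sub, map_mul, map_natCast, map_zero,
        Algebra.algebraMap_self, RingHom.id_apply, y] at h3 ⊢
      field_simp
      linear_combination (-algebraMap _ L b) * h3
  obtain ⟨x, hx⟩ := IsIntegrallyClosed.isIntegral_iff.1 hy
  have hpx : (p : NumberField.RingOfIntegers L) * x = aeval θ (S ^ (p - 1) + (p : ℤ[X]) * Q) := by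
    apply NumberField.RingOfIntegers.coe_injective
    rw [map_mul, hx, map_natCast]
    simp only [map_add, map_mul, map_pow, map_natCast]
    rw [← hu, ← map_pow, hup1]
    simp only [y, map_add, map_mul, map_pow, map_natCast]
    field_simp
    rfl
  refine ⟨x, ?_, ?_⟩
  · rw [hpx, Algebra.adjoin_singleton_eq_range_aeval]
    exact ⟨_, rfl⟩
  · rw [Algebra.adjoin_singleton_eq_range_aeval]
    rintro ⟨T, hT⟩
    change aeval θ T = x at hT
    have h4 := hmin (S ^ (p - 1) + (p : ℤ[X]) * Q - (p : ℤ[X]) * T) (by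
      rw [map_sub, ← hpx, map_mul, hT, map_natCast, sub_self])
    have h5 := Polynomial.map_dvd (Int.castRingHom (ZMod p)) h4
    simp only [Polynomial.map_add, Polynomial.map_sub, Polynomial.map_mul, Polynomial.map_pow,
      Polynomial.map_natCast, CharP.cast_eq_zero, zero_mul, add_zero,
      sub_zero] at h5
    have := (pow_dvd_pow_iff hirr.ne_zero hirr.not_isUnit).1 h5
    have := hp.pos
    omega

/-- The Shanks polynomial `x³ - k x² - (k + 3) x - 1`. -/
noncomputable def shanksPoly {R : Type*} [CommRing R] (k : R) : R[X] :=
  X ^ 3 - C k * X ^ 2 - C (k + 3) * X - 1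

theorem map_shanksPoly {R R' : Type*} [CommRing R] [CommRing R'] (f : R →+* R') (k : R) :
    (shanksPoly k).map f = shanksPoly (f k) := by
  simp [shanksPoly, map_ofNat]

theorem shanksPoly_eq_cubic {R : Type*} [CommRing R] (k : R) :
    shanksPoly k = C 1 * X ^ 3 + C (-k) * X ^ 2 + C (-(k + 3)) * X + C (-1) := by
  simp only [shanksPoly, map_neg, C_1]
  ring

theorem natDegree_shanksPoly {R : Type*} [CommRing R] [Nontrivial R] (k : R) :
    (shanksPoly k).natDegree = 3 := by
  rw [shanksPoly_eq_cubic, natDegree_cubic one_ne_zero]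

theorem monic_shanksPoly {R : Type*} [CommRing R] [Nontrivial R] (k : R) :
    (shanksPoly k).Monic := by
  rw [shanksPoly_eq_cubic, Monic, leadingCoeff_cubic one_ne_zero]

theorem exists_roots_shanksPoly {k : ℝ} (hk : 1 ≤ k) :
    ∃ a b c : ℝ, 1 < a ∧ b < -1 ∧ -1 / 2 < c ∧ c < 0 ∧ (shanksPoly k).eval a = 0 ∧
      (shanksPoly k).eval b = 0 ∧ (shanksPoly k).eval c = 0 := by
  have hcont (s : Set ℝ) : ContinuousOn (fun x => (shanksPoly k).eval x) s :=
    (shanksPoly k).continuous.continuousOn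
  have heval (x : ℝ) : (shanksPoly k).eval x = x ^ 3 - k * x ^ 2 - (k + 3) * x - 1 := by
    simp [shanksPoly]
  obtain ⟨a, ha, ha0⟩ := intermediate_value_Ioo (show (1 : ℝ) ≤ k + 3 by linarith) (hcont _)
    (show (0 : ℝ) ∈ _ by
      simp only [heval, Set.mem_Ioo]
      exact ⟨by nlinarith, by nlinarith⟩)
  obtain ⟨b, hb, hb0⟩ := intermediate_value_Ioo (show (-2 : ℝ) ≤ -1 by norm_num) (hcont _)
    (show (0 : ℝ) ∈ _ by
      simp only [heval, Set.mem_Ioo]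
      exact ⟨by linarith, by linarith⟩)
  obtain ⟨c, hc, hc0⟩ := intermediate_value_Ioo' (show (-1 / 2 : ℝ) ≤ 0 by norm_num) (hcont _)
    (show (0 : ℝ) ∈ _ by
      simp only [heval, Set.mem_Ioo]
      exact ⟨by linarith, by linarith⟩)
  exact ⟨a, b, c, ha.1, hb.2, hc.1, hc.2, ha0, hb0, hc0⟩

theorem eq_prod_X_sub_C_of_roots {R : Type*} [Field R] {f : R[X]} (hf : f.Monic)
    (hdeg : f.natDegree ≤ 3) {a b c : R} (hab : a ≠ b) (hac : a ≠ c) (hbc : b ≠ c)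
    (ha : f.eval a = 0) (hb : f.eval b = 0) (hc : f.eval c = 0) :
    f = (X - C a) * (X - C b) * (X - C c) := by
  refine (eq_of_monic_of_dvd_of_natDegree_le
    (((monic_X_sub_C a).mul (monic_X_sub_C b)).mul (monic_X_sub_C c)) hf ?_ ?_)
  · have hcop {x y : R} (h : x ≠ y) : IsCoprime (X - C x) (X - C y) :=
      isCoprime_X_sub_C_of_isUnit_sub (sub_ne_zero.2 h).isUnit
    exact ((hcop hac).mul_left (hcop hbc)).mul_dvd
      ((hcop hab).mul_dvd (dvd_iff_isRoot.2 ha) (dvd_iff_isRoot.2 hb)) (dvd_iff_isRoot.2 hc)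
  · rw [((monic_X_sub_C a).mul (monic_X_sub_C b)).natDegree_mul (monic_X_sub_C c),
      (monic_X_sub_C a).natDegree_mul (monic_X_sub_C b)]
    simpa using hdeg

theorem abs_prod_one_add_lt_one {p : ℕ} (hp : 3 ≤ p) (hodd : Odd p) {a b c : ℝ}
    (ha : 1 < a ^ p) (hb : b ^ p < -1) (hc : -1 / 2 < c ^ p) (hc' : c ^ p < 0)
    (h : (1 + a ^ p) * (1 + b ^ p) * (1 + c ^ p) = -1) :
    0 < |(1 + a) * (1 + b) * (1 + c)| ∧ |(1 + a) * (1 + b) * (1 + c)| < 1 := by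
  have hp0 : p ≠ 0 := by omega
  have hmono : StrictMono (fun x : ℝ => x ^ p) := hodd.strictMono_pow
  have ha1 : 1 < a := hmono.lt_iff_lt.1 (by simpa using ha)
  have hb1 : b < -1 := hmono.lt_iff_lt.1 (by simpa [hodd.neg_pow] using hb)
  have hc1 : -1 < c := hmono.lt_iff_lt.1 (by simp only [hodd.neg_pow, one_pow]; linarith)
  have hc2 : c < 0 := hodd.pow_neg_iff.1 hc'
  have haa : a ≤ a ^ p := le_self_pow₀ ha1.le hp0
  have hbern : (p : ℝ) * (-b - 1) ≤ -b ^ p - 1 := by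
    have := one_add_mul_le_pow (a := -b - 1) (by linarith) p
    rw [add_sub_cancel, hodd.neg_pow] at this
    linarith
  have hp3 : (3 : ℝ) ≤ p := by exact_mod_cast hp
  have hb3 : 3 * (-b - 1) ≤ -b ^ p - 1 :=
    (mul_le_mul_of_nonneg_right hp3 (by linarith)).trans hbern
  have hprod : (1 + a) * (1 + b) * (1 + c) = -((1 + a) * (-b - 1) * (1 + c)) := by ring
  have hpos : 0 < (1 + a) * (-b - 1) * (1 + c) :=
    mul_pos (mul_pos (by linarith) (by linarith)) (by linarith)
  rw [hprod, abs_neg, abs_of_pos hpos]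
  refine ⟨hpos, ?_⟩
  have h1 : (1 + a) * (3 * (-b - 1)) ≤ (1 + a ^ p) * (-b ^ p - 1) :=
    mul_le_mul (by linarith) hb3 (by linarith) (by linarith)
  have h2 : (1 + a ^ p) * (-b ^ p - 1) < 2 := by
    have hpos' : 0 < (1 + a ^ p) * (-b ^ p - 1) := mul_pos (by linarith) (by linarith)
    nlinarith
  have h3 : (1 + a) * (-b - 1) * (1 + c) ≤ (1 + a) * (-b - 1) * 1 :=
    mul_le_mul_of_nonneg_left (by linarith) (mul_pos (by linarith) (by linarith)).le
  linarith

theorem pow_ne_gen_of_minpoly_eq_shanksPoly {k : ℤ} (hk : 1 ≤ k) {p : ℕ} (hp : p.Prime)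
    {K : Type*} [Field K] {_ : Algebra ℚ K} (pb : PowerBasis ℚ K)
    (hpb : minpoly ℚ pb.gen = shanksPoly (k : ℚ)) (β : K) : β ^ p ≠ pb.gen := by
  intro hβ
  have hfin : Module.finrank ℚ K = 3 := by
    rw [pb.finrank, ← pb.natDegree_minpoly, hpb, natDegree_shanksPoly]
  have : FiniteDimensional ℚ K := pb.finite
  obtain ⟨a, b, c, ha, hb, hc, hc', ha0, hb0, hc0⟩ :=
    exists_roots_shanksPoly (k := (k : ℝ)) (by exact_mod_cast hk)
  have hlift (r : ℝ) (hr : (shanksPoly (k : ℝ)).eval r = 0) :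
      ∃ φ : K →ₐ[ℚ] ℝ, φ β ^ p = r := by
    refine ⟨pb.lift r ?_, ?_⟩
    · rw [hpb, aeval_def, eval₂_eq_eval_map, map_shanksPoly]
      simpa using hr
    · rw [← map_pow, hβ, PowerBasis.lift_gen]
  obtain ⟨φa, hφa⟩ := hlift a ha0
  obtain ⟨φb, hφb⟩ := hlift b hb0
  obtain ⟨φc, hφc⟩ := hlift c hc0
  rcases hp.eq_two_or_odd' with rfl | hodd
  · nlinarith [sq_nonneg (φb β)]
  have hp3 : 3 ≤ p := by
    have := hp.two_le
    obtain ⟨m, rfl⟩ := hodd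
    omega
  have hgen : IsIntegral ℤ pb.gen := by
    refine ⟨shanksPoly k, monic_shanksPoly k, ?_⟩
    have := minpoly.aeval ℚ pb.gen
    rw [hpb, aeval_def, eval₂_eq_eval_map, map_shanksPoly] at this
    rw [eval₂_eq_eval_map, map_shanksPoly]
    simpa using this
  have hβint : IsIntegral ℤ β := IsIntegral.of_pow hp.pos (hβ ▸ hgen)
  have hmin := minpoly.isIntegrallyClosed_eq_field_fractions' ℚ hβint
  have hdeg : (minpoly ℤ β).natDegree ≤ 3 := by
    rw [← (minpoly.monic hβint).natDegree_map (algebraMap ℤ ℚ), ← hmin, ← hfin]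
    exact minpoly.natDegree_le β
  have hroot (φ : K →ₐ[ℚ] ℝ) : ((minpoly ℤ β).map (Int.castRingHom ℝ)).eval (φ β) = 0 := by
    have h := minpoly.aeval ℤ β
    have := congrArg φ h
    rw [aeval_def, map_zero, ← AlgHom.coe_toRingHom, hom_eval₂] at this
    rw [← eval₂_eq_eval_map, ← this]
    congr 1
    exact RingHom.ext_int _ _
  have hf := eq_prod_X_sub_C_of_roots ((minpoly.monic hβint).map (Int.castRingHom ℝ))
    (((minpoly.monic hβint).natDegree_map _).trans_le hdeg)
    (a := φa β) (b := φb β) (c := φc β)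
    (by intro h; rw [h] at hφa; linarith) (by intro h; rw [h] at hφa; linarith)
    (by intro h; rw [h] at hφb; linarith) (hroot _) (hroot _) (hroot _)
  have hS := eq_prod_X_sub_C_of_roots (monic_shanksPoly (k : ℝ)) (natDegree_shanksPoly _).le
    (a := a) (b := b) (c := c) (by linarith) (by linarith) (by linarith) ha0 hb0 hc0
  have hS1 : (1 + a) * (1 + b) * (1 + c) = -1 := by
    have := congrArg (eval (-1)) hS
    simp only [shanksPoly, eval_sub, eval_mul, eval_pow, eval_X, eval_C, eval_one] at this
    linear_combination this
  have hf1 : (((minpoly ℤ β).eval (-1) : ℤ) : ℝ) = -((1 + φa β) * (1 + φb β) * (1 + φc β)) := by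
    have := congrArg (eval (-1)) hf
    have hcast : ((minpoly ℤ β).map (Int.castRingHom ℝ)).eval (-1) =
        (((minpoly ℤ β).eval (-1) : ℤ) : ℝ) := by
      have := eval_map_apply (p := minpoly ℤ β) (f := Int.castRingHom ℝ) (-1)
      simpa using this
    rw [hcast] at this
    rw [this]
    simp only [eval_sub, eval_mul, eval_X, eval_C]
    ring
  have hbound := abs_prod_one_add_lt_one hp3 hodd (a := φa β) (b := φb β) (c := φc β)
    (by rwa [hφa]) (by rwa [hφb]) (by rwa [hφc]) (by rwa [hφc]) (by rw [hφa, hφb, hφc, hS1])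
  rw [← abs_neg, ← hf1, ← Int.cast_abs] at hbound
  have h1 : 0 < |(minpoly ℤ β).eval (-1)| := by exact_mod_cast hbound.1
  have h2 : |(minpoly ℤ β).eval (-1)| < 1 := by exact_mod_cast hbound.2
  omega

theorem irreducible_expand_shanksPoly {k : ℤ} (hk : 1 ≤ k) {p : ℕ} (hp : p.Prime)
    (hirr : Irreducible (shanksPoly (k : ℚ))) : Irreducible (expand ℚ p (shanksPoly (k : ℚ))) := by
  rw [expand_eq_comp_X_pow]
  refine irreducible_comp (monic_shanksPoly _) (monic_X_pow p) hirr fun E _ _ x hx => ?_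
  rw [Polynomial.map_pow, map_X]
  have hxint : IsIntegral ℚ x := by
    by_contra h
    exact (monic_shanksPoly (k : ℚ)).ne_zero (hx ▸ minpoly.eq_zero h)
  refine X_pow_sub_C_irreducible_of_prime hp fun β => ?_
  rw [← adjoin.powerBasis_gen hxint]
  refine pow_ne_gen_of_minpoly_eq_shanksPoly hk hp (adjoin.powerBasis hxint) ?_ β
  rw [adjoin.powerBasis_gen]
  exact (minpoly_gen ℚ x).trans hx

theorem irreducible_shanksPoly_rat {k : ℤ} {p : ℕ} [Fact p.Prime]
    (hirr : Irreducible (shanksPoly (k : ZMod p))) : Irreducible (shanksPoly (k : ℚ)) := by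
  have h : Irreducible (shanksPoly k) := by
    refine (monic_shanksPoly k).irreducible_of_irreducible_map (Int.castRingHom (ZMod p)) _ ?_
    rwa [map_shanksPoly]
  have := ((monic_shanksPoly k).irreducible_iff_irreducible_map_fraction_map (K := ℚ)).1 h
  rwa [map_shanksPoly] at this

theorem finite_quotient_adjoin {L : Type*} [Field L] [NumberField L]
    {θ : NumberField.RingOfIntegers L} (hgen : ℚ⟮(θ : L)⟯ = ⊤) :
    Finite (NumberField.RingOfIntegers L ⧸
      (Algebra.adjoin ℤ ({θ} : Set (NumberField.RingOfIntegers L))).toSubring.toAddSubgroup) := by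
  have hint : IsIntegral ℤ θ := NumberField.RingOfIntegers.isIntegral θ
  refine Submodule.finiteQuotientOfFreeOfRankEq
    (Subalgebra.toSubmodule (Algebra.adjoin ℤ ({θ} : Set (NumberField.RingOfIntegers L)))) ?_
  have h1 := (Algebra.adjoin.powerBasis' hint).finrank
  have hθ : IsIntegral ℚ (θ : L) := Algebra.IsIntegral.isIntegral _
  rw [Algebra.adjoin.powerBasis'_dim] at h1
  rw [NumberField.RingOfIntegers.rank, ← IntermediateField.finrank_top', ← hgen,
    adjoin.finrank hθ, minpoly.isIntegrallyClosed_eq_field_fractions ℚ L hint,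
    (minpoly.monic hint).natDegree_map]
  exact h1

theorem Subring.dvd_index_toAddSubgroup_iff {R : Type*} [CommRing R] {p : ℕ} (hp : p.Prime) {A : Subring R}
    [Finite (R ⧸ A.toAddSubgroup)] :
    p ∣ A.toAddSubgroup.index ↔ ∃ x, (p : R) * x ∈ A ∧ x ∉ A := by
  have : Fact p.Prime := ⟨hp⟩
  rw [AddSubgroup.index]
  have hmem (y : R) : (QuotientAddGroup.mk y : R ⧸ A.toAddSubgroup) = 0 ↔ y ∈ A :=
    QuotientAddGroup.eq_zero_iff y
  constructor
  · intro h
    obtain ⟨x, hx⟩ := exists_prime_addOrderOf_dvd_card' p h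
    obtain ⟨x, rfl⟩ := QuotientAddGroup.mk_surjective x
    refine ⟨x, ?_, fun hxA => ?_⟩
    · rw [← hmem, ← nsmul_eq_mul, QuotientAddGroup.mk_nsmul, ← hx, addOrderOf_nsmul_eq_zero]
    · rw [(hmem x).2 hxA, addOrderOf_zero] at hx
      exact hp.one_lt.ne hx
  · rintro ⟨x, hpx, hx⟩
    rw [← hmem, ← nsmul_eq_mul, QuotientAddGroup.mk_nsmul] at hpx
    rw [← hmem] at hx
    rw [← addOrderOf_eq_prime hpx hx]
    exact addOrderOf_dvd_natCard _

theorem NumberField.RingOfIntegers.not_isUnit_natCast {L : Type*} [Field L] [NumberField L] {p : ℕ}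
    (hp : p.Prime) : ¬ IsUnit (p : NumberField.RingOfIntegers L) := by
  intro h
  have h' : IsUnit (algebraMap ℤ (NumberField.RingOfIntegers L) (p : ℤ)) := by simpa using h
  have := isUnit_of_map_unit _ _ h'
  exact hp.ne_one (Int.ofNat_isUnit.1 this |> Nat.isUnit_iff.1)

/-- Let `k ≥ 1` with `k ≢ 3 (mod 9)` be such that `D` is
squarefree, and let `p` be a prime such that the Shanks polynomial
`S_k(x) = x³ − k·x² − (k+3)·x − 1` is irreducible in `𝔽_p[x]`.  Let `θ` be a
root of the irreducible polynomial `S_k(x^p)`, `L = ℚ(θ)` and `Z_L` the ring of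
integers of `L`.  Then `p ∣ [Z_L : ℤ[θ]]` if and only if the image of the
polynomial `S_k(x^p)` is zero in the ring `(ℤ/p²ℤ)[x]/(S_k(x))`. -/
theorem shanks_index_iff (k : ℤ) (hk : 1 ≤ k) (hk9 : ¬ k ≡ 3 [ZMOD 9])
    (hD : Squarefree (if (3 : ℤ) ∣ k then (k / 3) ^ 2 + k / 3 + 1 else k ^ 2 + 3 * k + 9))
    (p : ℕ) (hp : p.Prime)
    (hirr : Irreducible (X ^ 3 - C (k : ZMod p) * X ^ 2 - C ((k : ZMod p) + 3) * X - 1))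
    (L : Type*) [Field L] [NumberField L] (θ : NumberField.RingOfIntegers L)
    (hθ : θ ^ (3 * p) - (k : NumberField.RingOfIntegers L) * θ ^ (2 * p)
      - ((k : NumberField.RingOfIntegers L) + 3) * θ ^ p - 1 = 0)
    (hgen : ℚ⟮(θ : L)⟯ = ⊤) :
    (p : ℕ) ∣ (Algebra.adjoin ℤ ({θ} : Set (NumberField.RingOfIntegers L))).toSubring.toAddSubgroup.index ↔
      Ideal.Quotient.mk (Ideal.span ({X ^ 3 - C (k : ZMod (p ^ 2)) * X ^ 2
          - C ((k : ZMod (p ^ 2)) + 3) * X - 1} : Set (ZMod (p ^ 2))[X]))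
        (X ^ (3 * p) - C (k : ZMod (p ^ 2)) * X ^ (2 * p)
          - C ((k : ZMod (p ^ 2)) + 3) * X ^ p - 1) = 0 := by
  have : Fact p.Prime := ⟨hp⟩
  have hfin := finite_quotient_adjoin hgen
  have hirrp : Irreducible (shanksPoly (k : ZMod p)) := hirr
  have hmap (n : ℕ) : (shanksPoly k).map (Int.castRingHom (ZMod n)) = shanksPoly (k : ZMod n) :=
    map_shanksPoly _ _
  have hirrS : Irreducible ((shanksPoly k).map (Int.castRingHom (ZMod p))) := by rwa [hmap]
  have hexp {R : Type} [CommRing R] (a : R) : expand R p (shanksPoly a) =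
      X ^ (3 * p) - C a * X ^ (2 * p) - C (a + 3) * X ^ p - 1 := by
    simp only [shanksPoly, map_sub, map_mul, map_pow, expand_C, expand_X, map_one, ← pow_mul]
    ring
  obtain ⟨G, hG⟩ : ∃ G : ℤ[X],
      expand ℤ p (shanksPoly k) = shanksPoly k ^ p + (p : ℤ[X]) * G := by
    apply exists_eq_add_C_mul_of_map_eq
    rw [map_expand, ZMod.expand_card, Polynomial.map_pow]
  have hroot : aeval θ (expand ℤ p (shanksPoly k)) = 0 := by
    rw [hexp, ← hθ]
    simp [map_ofNat]
  have hmin (T : ℤ[X]) (hT : aeval θ T = 0) : expand ℤ p (shanksPoly k) ∣ T := by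
    have hirrF := irreducible_expand_shanksPoly hk hp (irreducible_shanksPoly_rat hirrp)
    have hFmap : (expand ℤ p (shanksPoly k)).map (algebraMap ℤ ℚ) =
        expand ℚ p (shanksPoly (k : ℚ)) := by
      rw [map_expand, map_shanksPoly, eq_intCast]
    have haeval (f : ℤ[X]) (hf : aeval θ f = 0) : aeval (θ : L) (f.map (algebraMap ℤ ℚ)) = 0 := by
      rw [aeval_map_algebraMap, aeval_algebraMap_apply, hf, map_zero]
    have hminF := minpoly.eq_of_irreducible_of_monic (hFmap ▸ hirrF) (haeval _ hroot)
      (((monic_shanksPoly k).expand hp.pos).map _)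
    rw [← map_dvd_map (algebraMap ℤ ℚ) (algebraMap ℤ ℚ).injective_int
      ((monic_shanksPoly k).expand hp.pos), hminF]
    exact minpoly.dvd ℚ _ (haeval T hT)
  rw [Subring.dvd_index_toAddSubgroup_iff hp, Ideal.Quotient.eq_zero_iff_mem, Ideal.mem_span_singleton,
    ← hexp]
  change _ ↔ shanksPoly (k : ZMod (p ^ 2)) ∣ _
  rw [← hmap, ← map_expand, map_dvd_map_sq_iff hp hirrS hG]
  rw [hG] at hroot hmin
  exact ⟨fun ⟨x, hpx, hx⟩ => map_dvd_map_of_mul_mem_adjoin hp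
    (NumberField.RingOfIntegers.not_isUnit_natCast hp) hirrS hroot hpx hx,
    exists_mul_mem_adjoin_of_map_dvd_map hp hirrS hroot hmin⟩
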